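/- Let A, B, C be affinely independent points in the Euclidean plane with ∠ABC = π/2, and write a = dist B C, b = dist C A, c = dist A B, s = (a+b+c)/2. Let D be the point on segment AC with dist A D = s − a (so BD is the Gergonne cevian from B). Then dist A D · dist C D = area(A, B, C), where area(A, B, C) is the 2-dimensional Lebesgue measure of the convex hull of {A, B, C}. -/

import Mathlib

open EuclideanGeometry Real MeasureTheory RealInnerProductSpace

noncomputable def area (P Q R : EuclideanSpace ℝ (Fin 2)) : ℝ :=
  (MeasureTheory.volume (convexHull ℝ ({P, Q, R} : Set (EuclideanSpace ℝ (Fin 2))))).toReal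

def stdT : Set (EuclideanSpace ℝ (Fin 2)) := {p | 0 ≤ p 0 ∧ 0 ≤ p 1 ∧ p 0 + p 1 ≤ 1}

def stdT2 : Set (ℝ × ℝ) := {p | 0 ≤ p.1 ∧ 0 ≤ p.2 ∧ p.1 + p.2 ≤ 1}

lemma stdT2_closed : IsClosed stdT2 := by
  have h1 : IsClosed {p : ℝ × ℝ | 0 ≤ p.1} := isClosed_le (by fun_prop) (by fun_prop)
  have h2 : IsClosed {p : ℝ × ℝ | 0 ≤ p.2} := isClosed_le (by fun_prop) (by fun_prop)
  have h3 : IsClosed {p : ℝ × ℝ | p.1 + p.2 ≤ 1} := isClosed_le (by fun_prop) (by fun_prop)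
  exact h1.inter (h2.inter h3)

lemma vol_stdT2 : volume stdT2 = ENNReal.ofReal (1 / 2) := by
  rw [Measure.volume_eq_prod, Measure.prod_apply stdT2_closed.measurableSet]
  have h : ∀ x : ℝ, volume (Prod.mk x ⁻¹' stdT2)
      = (Set.Icc (0:ℝ) 1).indicator (fun x => ENNReal.ofReal (1 - x)) x := by
    intro x
    by_cases hx : x ∈ Set.Icc (0:ℝ) 1
    · rw [Set.indicator_of_mem hx]
      have : Prod.mk x ⁻¹' stdT2 = Set.Icc 0 (1 - x) := by
        ext y
        simp only [stdT2, Set.mem_preimage, Set.mem_setOf_eq, Set.mem_Icc]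
        constructor
        · rintro ⟨h1, h2, h3⟩; exact ⟨h2, by linarith⟩
        · rintro ⟨h1, h2⟩; exact ⟨hx.1, h1, by linarith⟩
      rw [this, Real.volume_Icc, sub_zero]
    · rw [Set.indicator_of_notMem hx]
      have : Prod.mk x ⁻¹' stdT2 = ∅ := by
        ext y
        simp only [stdT2, Set.mem_preimage, Set.mem_setOf_eq, Set.mem_empty_iff_false, iff_false]
        rintro ⟨h1, h2, h3⟩; exact hx ⟨h1, by linarith⟩
      rw [this, measure_empty]
  simp_rw [h]
  rw [lintegral_indicator measurableSet_Icc, ← ofReal_integral_eq_lintegral_ofReal]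
  · rw [integral_Icc_eq_integral_Ioc, ← intervalIntegral.integral_of_le zero_le_one]
    congr 1
    rw [intervalIntegral.integral_sub (by simp) (by simp)]
    simp
    norm_num
  · exact (by fun_prop : Continuous fun x : ℝ => 1 - x).integrableOn_Icc
  · filter_upwards [ae_restrict_mem measurableSet_Icc] with x hx
    simpa using hx.2

lemma vol_stdT : volume stdT = ENNReal.ofReal (1 / 2) := by
  have h1 := (volume_preserving_finTwoArrow ℝ).comp
    (EuclideanSpace.volume_preserving_symm_measurableEquiv_toLp (Fin 2))
  rw [← vol_stdT2, ← h1.measure_preimage stdT2_closed.measurableSet.nullMeasurableSet]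
  rfl

lemma hull_eq (A B C : EuclideanSpace ℝ (Fin 2)) :
    convexHull ℝ ({A, B, C} : Set (EuclideanSpace ℝ (Fin 2))) =
      (fun x => B + x) '' ((fun p : EuclideanSpace ℝ (Fin 2) => p 0 • (A - B) + p 1 • (C - B)) '' stdT) := by
  rw [Set.insert_comm, Set.image_image]
  ext x
  constructor
  · rw [convexHull_insert (by simp), convexHull_pair, mem_convexJoin]
    rintro ⟨b, hb, y, ⟨γ, δ, hγ, hδ, hs, rfl⟩, ⟨α, β, hα, hβ, hs2, rfl⟩⟩
    rw [Set.mem_singleton_iff] at hb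
    subst hb
    refine ⟨!₂[β * γ, β * δ], ⟨?_, ?_, ?_⟩, ?_⟩
    · simpa using mul_nonneg hβ hγ
    · simpa using mul_nonneg hβ hδ
    · simp only [PiLp.toLp_apply, Matrix.cons_val_zero, Matrix.cons_val_one]
      rw [← mul_add, hs]; linarith
    · obtain rfl : α = 1 - β := by linarith
      obtain rfl : γ = 1 - δ := by linarith
      simp only [PiLp.toLp_apply, Matrix.cons_val_zero, Matrix.cons_val_one]
      module
  · rintro ⟨p, ⟨h0, h1, h2⟩, rfl⟩
    have hc := convex_convexHull ℝ ({B, A, C} : Set (EuclideanSpace ℝ (Fin 2)))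
    have := hc.sum_mem (t := Finset.univ) (w := ![1 - p 0 - p 1, p 0, p 1]) (z := ![B, A, C])
      (by intro i _; fin_cases i <;> simp <;> linarith)
      (by simp [Fin.sum_univ_three]; ring)
      (by intro i _; apply subset_convexHull; fin_cases i <;> simp)
    convert this using 1
    simp [Fin.sum_univ_three]
    module

lemma area_eq (A B C : EuclideanSpace ℝ (Fin 2)) :
    area A B C = |(A - B) 0 * (C - B) 1 - (A - B) 1 * (C - B) 0| / 2 := by
  unfold area
  set u := A - B with hu
  set v := C - B with hv
  let M : Matrix (Fin 2) (Fin 2) ℝ := !![u 0, v 0; u 1, v 1]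
  have hM : (fun p : EuclideanSpace ℝ (Fin 2) => p 0 • u + p 1 • v) = Matrix.toLpLin 2 2 M := by
    funext p
    ext i
    fin_cases i <;> simp [M, Matrix.toLpLin_apply, Matrix.mulVec, dotProduct, Fin.sum_univ_two] <;> ring
  rw [hull_eq, Set.image_add_left, measure_preimage_add, hM, Measure.addHaar_image_linearMap, vol_stdT]
  have : LinearMap.det (Matrix.toLpLin 2 2 M) = u 0 * v 1 - u 1 * v 0 := by
    rw [Matrix.toLpLin_eq_toLin, LinearMap.det_toLin, Matrix.det_fin_two]
    simp [M]; ring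
  rw [this, ENNReal.toReal_mul, ENNReal.toReal_ofReal (abs_nonneg _), ENNReal.toReal_ofReal (by norm_num)]
  ring

theorem gergonne_cevian_right_triangle_area
    (A B C : EuclideanSpace ℝ (Fin 2))
    (hABC : AffineIndependent ℝ ![A, B, C])
    (hB : ∠ A B C = π / 2)
    (a b c s : ℝ)
    (ha : a = dist B C) (hb : b = dist C A) (hc : c = dist A B)
    (hs : s = (a + b + c) / 2)
    (D : EuclideanSpace ℝ (Fin 2))
    (hD : D ∈ segment ℝ A C) (hDd : dist A D = s - a) :
    dist A D * dist C D = area A B C := by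
  have h1 : dist A D + dist D C = dist A C := dist_add_dist_of_mem_segment hD
  have hi : inner ℝ (A - B) (C - B) = 0 := by
    have := InnerProductGeometry.inner_eq_zero_iff_angle_eq_pi_div_two (A - B) (C - B)
    exact this.2 hB
  have hP : dist A C * dist A C = dist A B * dist A B + dist C B * dist C B :=
    (EuclideanGeometry.dist_sq_eq_dist_sq_add_dist_sq_iff_angle_eq_pi_div_two A B C).2 hB
  rw [dist_comm D C] at h1
  rw [dist_comm] at ha hb
  have key : dist A D * dist C D = a * c / 2 := by
    have : dist C D = b - (s - a) := by linarith
    rw [this, hDd, hs]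
    rw [← ha, ← hb, ← hc] at hP
    nlinarith
  rw [key, area_eq]
  congr 1
  rw [ha, hc, dist_eq_norm, dist_eq_norm]
  rw [← abs_of_nonneg (by positivity : 0 ≤ ‖C - B‖ * ‖A - B‖), ← sq_eq_sq_iff_abs_eq_abs, mul_pow,
    EuclideanSpace.norm_sq_eq, EuclideanSpace.norm_sq_eq]
  generalize A - B = u at *
  generalize C - B = v at *
  simp [Fin.sum_univ_two, PiLp.inner_apply] at hi ⊢
  linear_combination (v 0 * u 0 + v 1 * u 1) * hi
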